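/- For every x ∈ H, the resolvent set J_f x = {z ∈ K : f(z,y) + ⟨z − x, y − z⟩ ≥ 0 for all y ∈ K} is nonempty; that is, the domain of the resolvent operator J_f is all of H. -/

import Mathlib

open scoped RealInnerProductSpace

/-- A family of closed convex sets of a Hilbert space with the finite intersection property,
one member of which is bounded, has nonempty intersection. -/
theorem nonempty_iInter_of_isClosed_of_convex {H ι : Type*} [NormedAddCommGroup H]
    [InnerProductSpace ℝ H] [CompleteSpace H] {T : ι → Set H} (hclosed : ∀ i, IsClosed (T i))
    (hconvex : ∀ i, Convex ℝ (T i)) (hfin : ∀ s : Finset ι, (⋂ i ∈ s, T i).Nonempty)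
    {i₀ : ι} {R : ℝ} (hR : ∀ z ∈ T i₀, ‖z‖ ≤ R) : (⋂ i, T i).Nonempty := by
  classical
  let C : Finset ι → Set H := fun s => ⋂ i ∈ insert i₀ s, T i
  have hCclosed (s : Finset ι) : IsClosed (C s) := isClosed_biInter fun i _ => hclosed i
  have hCconvex (s : Finset ι) : Convex ℝ (C s) := convex_iInter₂ fun i _ => hconvex i
  have hCanti {s t : Finset ι} (hst : s ≤ t) : C t ⊆ C s :=
    Set.biInter_subset_biInter_left (Finset.insert_subset_insert i₀ hst)
  choose p hpC hpmin using fun s =>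
    exists_norm_eq_iInf_of_complete_convex (hfin (insert i₀ s)) (hCclosed s).isComplete
      (hCconvex s) 0
  have hdist {s t : Finset ι} (hst : s ≤ t) : ‖p t - p s‖ ^ 2 ≤ ‖p t‖ ^ 2 - ‖p s‖ ^ 2 := by
    have h := (norm_eq_iInf_iff_real_inner_le_zero (hCconvex s) (hpC s)).1 (hpmin s) (p t)
      (hCanti hst (hpC t))
    have h' : ⟪p t, p s⟫ = ⟪p s, p t⟫ := real_inner_comm _ _
    simp only [zero_sub, inner_neg_left, inner_sub_right, real_inner_self_eq_norm_sq] at h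
    rw [norm_sub_sq_real]
    linarith
  have hmono : Monotone fun s => ‖p s‖ ^ 2 := fun s t hst => by
    have := hdist hst
    have := sq_nonneg ‖p t - p s‖
    simp only
    linarith
  have hbdd : BddAbove (Set.range fun s => ‖p s‖ ^ 2) := by
    refine ⟨R ^ 2, ?_⟩
    rintro _ ⟨s, rfl⟩
    exact pow_le_pow_left₀ (norm_nonneg _)
      (hR _ (Set.mem_iInter₂.1 (hpC s) i₀ (Finset.mem_insert_self _ _))) 2
  have hlim := tendsto_atTop_ciSup hmono hbdd
  set L := ⨆ s, ‖p s‖ ^ 2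
  have hcauchy : CauchySeq p := by
    refine Metric.cauchySeq_iff'.2 fun ε hε => ?_
    obtain ⟨s, hs⟩ := (hlim.eventually (lt_mem_nhds (sub_lt_self L (pow_pos hε 2)))).exists
    refine ⟨s, fun t hst => ?_⟩
    rw [dist_eq_norm]
    refine lt_of_pow_lt_pow_left₀ 2 hε.le ?_
    have h1 : ‖p t‖ ^ 2 ≤ L := le_ciSup hbdd t
    have h2 := hdist hst
    linarith
  obtain ⟨z, hz⟩ := cauchySeq_tendsto_of_complete hcauchy
  refine ⟨z, Set.mem_iInter.2 fun i => (hclosed i).mem_of_tendsto hz ?_⟩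
  filter_upwards [Filter.eventually_ge_atTop {i}] with s hs
  exact Set.mem_iInter₂.1 (hpC s) i
    (Finset.mem_insert_of_mem (hs (Finset.mem_singleton_self i)))

/-- If finitely many convex functions are nowhere simultaneously negative, then some convex
combination of them is nonnegative. -/
theorem exists_sum_mul_nonneg_of_convexOn {E ι : Type*} [AddCommGroup E] [Module ℝ E]
    [Fintype ι] {K : Set E} (hK : K.Nonempty) {g : ι → E → ℝ} (hg : ∀ i, ConvexOn ℝ K (g i))
    (h : ∀ z ∈ K, ∃ i, 0 ≤ g i z) :
    ∃ w ∈ stdSimplex ℝ ι, ∀ z ∈ K, 0 ≤ ∑ i, w i * g i z := by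
  classical
  obtain ⟨z₀, hz₀⟩ := hK
  obtain ⟨i₀, -⟩ := h z₀ hz₀
  let C : Set (ι → ℝ) := {v | ∃ z ∈ K, ∀ i, g i z < v i}
  have hCopen : IsOpen C := by
    have : C = ⋃ z ∈ K, Set.univ.pi fun i => Set.Ioi (g i z) := by
      ext v
      simp [C]
    rw [this]
    exact isOpen_biUnion fun z _ => isOpen_set_pi Set.finite_univ fun i _ => isOpen_Ioi
  have hCconvex : Convex ℝ C := by
    rintro u ⟨y, hy, hyu⟩ v ⟨z, hz, hzv⟩ a b ha hb hab
    refine ⟨a • y + b • z, (hg i₀).1 hy hz ha hb hab, fun i => ?_⟩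
    refine ((hg i).2 hy hz ha hb hab).trans_lt ?_
    simp only [smul_eq_mul, Pi.add_apply, Pi.smul_apply]
    have h1 := hyu i
    have h2 := hzv i
    rcases ha.eq_or_lt with rfl | ha
    · have : b = 1 := by linarith
      subst this
      linarith
    · have := mul_lt_mul_of_pos_left h1 ha
      have := mul_le_mul_of_nonneg_left h2.le hb
      linarith
  have h0C : (0 : ι → ℝ) ∉ C := by
    rintro ⟨z, hz, hlt⟩
    obtain ⟨i, hi⟩ := h z hz
    exact (hlt i).not_ge hi
  obtain ⟨φ, hφ⟩ := geometric_hahn_banach_point_open hCconvex hCopen h0C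
  simp only [map_zero] at hφ
  let c : ι → ℝ := fun i => φ (Pi.single i 1)
  have hφc (v : ι → ℝ) : φ v = ∑ i, c i * v i := by
    conv_lhs => rw [pi_eq_sum_univ' v]
    simp [c, mul_comm]
  have hC0 {v : ι → ℝ} (hv : ∀ i, g i z₀ < v i) : 0 < ∑ i, c i * v i := by
    rw [← hφc]
    exact hφ v ⟨z₀, hz₀, hv⟩
  have hcnonneg (j : ι) : 0 ≤ c j := by
    by_contra! hj
    let v : ι → ℝ := fun i => g i z₀ + 1
    have hv : 0 < φ v := hφ v ⟨z₀, hz₀, fun i => lt_add_one _⟩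
    have ht : 0 < φ v / -c j := div_pos hv (neg_pos.2 hj)
    have := hφ (v + (φ v / -c j) • Pi.single j 1) ⟨z₀, hz₀, fun i => by
      have : (0 : ℝ) ≤ (Pi.single j 1 : ι → ℝ) i := by
        by_cases hij : i = j
        · subst hij; simp
        · simp [hij]
      have := mul_nonneg ht.le this
      simp only [Pi.add_apply, Pi.smul_apply, smul_eq_mul, v]
      linarith⟩
    rw [map_add, map_smul, smul_eq_mul] at this
    change 0 < φ v + φ v / -c j * c j at this
    have hcj : c j ≠ 0 := hj.ne
    have : φ v / -c j * c j = -φ v := by field_simp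
    linarith
  have hsum : 0 < ∑ i, c i := by
    refine (Finset.sum_nonneg fun i _ => hcnonneg i).lt_of_ne' fun h0 => ?_
    have hc0 := (Finset.sum_eq_zero_iff_of_nonneg fun i _ => hcnonneg i).1 h0
    have := hC0 (v := fun i => g i z₀ + 1) fun i => lt_add_one _
    rw [Finset.sum_eq_zero fun i hi => by rw [hc0 i hi, zero_mul]] at this
    exact this.false
  have hcg (z : E) (hz : z ∈ K) : 0 ≤ ∑ i, c i * g i z := by
    refine le_of_forall_pos_le_add fun ε hε => ?_
    have := hφ (fun i => g i z + ε / ∑ i, c i)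
      ⟨z, hz, fun i => lt_add_of_pos_right _ (div_pos hε hsum)⟩
    rw [hφc] at this
    simp only [mul_add, Finset.sum_add_distrib, ← Finset.sum_mul] at this
    rw [mul_div_cancel₀ _ hsum.ne'] at this
    exact this.le
  refine ⟨fun i => c i / ∑ i, c i, ⟨fun i => div_nonneg (hcnonneg i) hsum.le, ?_⟩, fun z hz => ?_⟩
  · rw [← Finset.sum_div, div_self hsum.ne']
  · simp only [div_mul_eq_mul_div, ← Finset.sum_div]
    exact div_nonneg (hcg z hz) hsum.le

/-- A convex function that is lower semicontinuous at a point decreases at most linearly away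
from that point. -/
theorem ConvexOn.exists_sub_mul_norm_le {E : Type*} [NormedAddCommGroup E] [NormedSpace ℝ E]
    {K : Set E} {h : E → ℝ} (hconv : ConvexOn ℝ K h) {y : E} (hy : y ∈ K)
    (hlsc : LowerSemicontinuousWithinAt h K y) :
    ∃ M, 0 ≤ M ∧ ∀ z ∈ K, h y - 1 - M * ‖z - y‖ ≤ h z := by
  have hev := hlsc (h y - 1) (sub_one_lt _)
  obtain ⟨r, hr, hball⟩ := Metric.mem_nhdsWithin_iff.1 hev
  refine ⟨2 / r, by positivity, fun z hz => ?_⟩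
  by_cases hzr : ‖z - y‖ < r
  · have : h y - 1 < h z := hball ⟨by rwa [Metric.mem_ball, dist_eq_norm], hz⟩
    have : 0 ≤ 2 / r * ‖z - y‖ := by positivity
    linarith
  · push Not at hzr
    have hd : 0 < ‖z - y‖ := hr.trans_le hzr
    set s := r / (2 * ‖z - y‖) with hs
    have hs0 : 0 < s := by positivity
    have hs1 : s ≤ 1 := by
      rw [hs, div_le_one (by positivity)]
      linarith
    have hmem : (1 - s) • y + s • z ∈ K :=
      hconv.1 hy hz (sub_nonneg.2 hs1) hs0.le (sub_add_cancel _ _)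
    have hle := hconv.2 hy hz (sub_nonneg.2 hs1) hs0.le (sub_add_cancel _ _)
    have hlt : h y - 1 < h ((1 - s) • y + s • z) := by
      refine hball ⟨?_, hmem⟩
      have : (1 - s) • y + s • z - y = s • (z - y) := by module
      rw [Metric.mem_ball, dist_eq_norm, this, norm_smul, Real.norm_of_nonneg hs0.le, hs]
      have : r / (2 * ‖z - y‖) * ‖z - y‖ = r / 2 := by field_simp
      linarith
    simp only [smul_eq_mul] at hle
    have hinv : s * (2 / r * ‖z - y‖) = 1 := by
      rw [hs]
      field_simp
    have : s * (h y - 2 / r * ‖z - y‖) ≤ s * h z := by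
      rw [mul_sub, hinv]
      linarith
    have := le_of_mul_le_mul_left this hs0
    linarith

theorem convexOn_inner_sub_sub {H : Type*} [NormedAddCommGroup H] [InnerProductSpace ℝ H]
    {K : Set H} (hK : Convex ℝ K) (x y : H) : ConvexOn ℝ K fun z => ⟪z - x, z - y⟫ := by
  refine ⟨hK, fun u _ v _ a b ha hb hab => ?_⟩
  have hb' : b = 1 - a := by linarith
  have key : ⟪a • u + b • v - x, a • u + b • v - y⟫
      = a * ⟪u - x, u - y⟫ + b * ⟪v - x, v - y⟫ - a * b * ⟪u - v, u - v⟫ := by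
    subst hb'
    have : ⟪v, u⟫ = ⟪u, v⟫ := real_inner_comm _ _
    have : ⟪x, u⟫ = ⟪u, x⟫ := real_inner_comm _ _
    have : ⟪x, v⟫ = ⟪v, x⟫ := real_inner_comm _ _
    simp only [inner_sub_left, inner_sub_right, inner_add_left, inner_add_right,
      real_inner_smul_left, real_inner_smul_right, *]
    ring
  have h0 : 0 ≤ a * b * ⟪u - v, u - v⟫ := mul_nonneg (mul_nonneg ha hb) real_inner_self_nonneg
  simp only [smul_eq_mul]
  rw [key]
  linarith

/-- Solutions of finitely many of the dual (Minty) inequalities, up to positive errors. -/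
theorem exists_forall_add_inner_lt {H ι : Type*} [NormedAddCommGroup H] [InnerProductSpace ℝ H]
    [Fintype ι] {K : Set H} (hK_ne : K.Nonempty) (hK_convex : Convex ℝ K) {f : H → H → ℝ}
    (hmono : ∀ x ∈ K, ∀ y ∈ K, f x y + f y x ≤ 0) (hconv : ∀ x ∈ K, ConvexOn ℝ K (f x))
    (x : H) {y : ι → H} (hy : ∀ i, y i ∈ K) {ε : ι → ℝ} (hε : ∀ i, 0 < ε i) :
    ∃ z ∈ K, ∀ i, f (y i) z + ⟪z - x, z - y i⟫ < ε i := by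
  by_contra! hcon
  obtain ⟨w, ⟨hw0, hw1⟩, hw⟩ := exists_sum_mul_nonneg_of_convexOn hK_ne
    (g := fun i z => f (y i) z + ⟪z - x, z - y i⟫ + -ε i)
    (fun i => ((hconv _ (hy i)).add (convexOn_inner_sub_sub hK_convex x (y i))).add_const (-ε i))
    (fun z hz => by
      obtain ⟨i, hi⟩ := hcon z hz
      exact ⟨i, by linarith⟩)
  set z := ∑ i, w i • y i with hz
  have hzK : z ∈ K := hK_convex.sum_mem (fun i _ => hw0 i) hw1 fun i _ => hy i
  have hinner : ∑ i, w i * ⟪z - x, z - y i⟫ = 0 := by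
    have : ∑ i, w i • (z - y i) = 0 := by
      simp only [smul_sub, Finset.sum_sub_distrib, ← Finset.sum_smul, hw1, one_smul]
      exact sub_self z
    simp only [← real_inner_smul_right, ← inner_sum, this, inner_zero_right]
  have hf : ∑ i, w i * f (y i) z ≤ ∑ i, ∑ j, w i * w j * f (y i) (y j) := by
    refine Finset.sum_le_sum fun i _ => ?_
    have := (hconv _ (hy i)).map_sum_le (t := Finset.univ) (fun j _ => hw0 j) hw1 fun j _ => hy j
    refine (mul_le_mul_of_nonneg_left this (hw0 i)).trans_eq ?_
    simp only [Finset.mul_sum, smul_eq_mul, mul_assoc]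
  have hff : ∑ i, ∑ j, w i * w j * f (y i) (y j) ≤ 0 := by
    have hcomm : ∑ i, ∑ j, w i * w j * f (y i) (y j) = ∑ i, ∑ j, w i * w j * f (y j) (y i) := by
      rw [Finset.sum_comm]
      simp only [mul_comm]
    have : ∑ i, ∑ j, w i * w j * (f (y i) (y j) + f (y j) (y i)) ≤ 0 :=
      Finset.sum_nonpos fun i _ => Finset.sum_nonpos fun j _ =>
        mul_nonpos_of_nonneg_of_nonpos (mul_nonneg (hw0 i) (hw0 j)) (hmono _ (hy i) _ (hy j))
    simp only [mul_add, Finset.sum_add_distrib] at this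
    linarith
  have hεpos : 0 < ∑ i, w i * ε i := by
    refine (Finset.sum_nonneg fun i _ => mul_nonneg (hw0 i) (hε i).le).lt_of_ne' fun h0 => ?_
    have h0' := (Finset.sum_eq_zero_iff_of_nonneg
      fun i _ => mul_nonneg (hw0 i) (hε i).le).1 h0
    have : ∑ i, w i = 0 := Finset.sum_eq_zero fun i hi =>
      (mul_eq_zero.1 (h0' i hi)).resolve_right (hε i).ne'
    linarith
  have := hw z hzK
  simp only [mul_add, mul_neg, Finset.sum_add_distrib, Finset.sum_neg_distrib, hinner] at this
  linarith

/-- Existence of a solution of the dual (Minty) form of the regularised equilibrium problem. -/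
theorem exists_forall_add_inner_nonpos {H : Type*} [NormedAddCommGroup H]
    [InnerProductSpace ℝ H] [CompleteSpace H] {K : Set H} (hK_ne : K.Nonempty)
    (hK_closed : IsClosed K) (hK_convex : Convex ℝ K) {f : H → H → ℝ}
    (hdiag : ∀ x ∈ K, f x x = 0) (hmono : ∀ x ∈ K, ∀ y ∈ K, f x y + f y x ≤ 0)
    (hlsc : ∀ x ∈ K, LowerSemicontinuousOn (f x) K) (hconv : ∀ x ∈ K, ConvexOn ℝ K (f x))
    (x : H) : ∃ z ∈ K, ∀ y ∈ K, f y z + ⟪z - x, z - y⟫ ≤ 0 := by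
  obtain ⟨y₀, hy₀⟩ := hK_ne
  let T : K × Set.Ioi (0 : ℝ) → Set H := fun i =>
    {z ∈ K | f i.1 z + ⟪z - x, z - i.1⟫ ≤ i.2}
  have hTclosed (i) : IsClosed (T i) := by
    have hcont : Continuous fun z : H => ⟪z - x, z - (i.1 : H)⟫ := by fun_prop
    obtain ⟨v, hv, hvK⟩ := lowerSemicontinuousOn_iff_preimage_Iic.1
      ((hlsc i.1 i.1.2).add (hcont.lowerSemicontinuous.lowerSemicontinuousOn K)) i.2
    have : T i = K ∩ v := hvK
    rw [this]
    exact hK_closed.inter hv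
  have hTconvex (i) : Convex ℝ (T i) :=
    ((hconv i.1 i.1.2).add (convexOn_inner_sub_sub hK_convex x i.1)).convex_le i.2
  have hTfin (s : Finset (K × Set.Ioi (0 : ℝ))) : (⋂ i ∈ s, T i).Nonempty := by
    obtain ⟨z, hz, hlt⟩ := exists_forall_add_inner_lt ⟨y₀, hy₀⟩ hK_convex hmono hconv x
      (y := fun i : s => (i.1.1 : H)) (fun i => i.1.1.2) (ε := fun i : s => (i.1.2 : ℝ))
      (fun i => i.1.2.2)
    exact ⟨z, Set.mem_iInter₂.2 fun i hi => ⟨hz, (hlt ⟨i, hi⟩).le⟩⟩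
  obtain ⟨M, hM, hMle⟩ := (hconv y₀ hy₀).exists_sub_mul_norm_le hy₀ (hlsc y₀ hy₀ y₀ hy₀)
  have hTbdd : ∀ z ∈ T (⟨y₀, hy₀⟩, ⟨1, Set.mem_Ioi.2 one_pos⟩), ‖z‖ ≤ ‖y₀‖ + (M + ‖y₀ - x‖ + 2) := by
    rintro z ⟨hz, hle⟩
    simp only at hle
    have h1 := hMle z hz
    rw [hdiag y₀ hy₀] at h1
    have h2 : ⟪z - x, z - y₀⟫ = ‖z - y₀‖ ^ 2 + ⟪y₀ - x, z - y₀⟫ := by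
      rw [← real_inner_self_eq_norm_sq, ← inner_add_left, sub_add_sub_cancel]
    have h3 := neg_le_of_abs_le (abs_real_inner_le_norm (y₀ - x) (z - y₀))
    have h4 : ‖z‖ ≤ ‖y₀‖ + ‖z - y₀‖ := norm_le_insert' z y₀
    have h5 : ‖z - y₀‖ ≤ M + ‖y₀ - x‖ + 2 := by
      by_contra! hlt
      have := norm_nonneg (y₀ - x)
      nlinarith
    linarith
  obtain ⟨z, hz⟩ := nonempty_iInter_of_isClosed_of_convex hTclosed hTconvex hTfin hTbdd
  rw [Set.mem_iInter] at hz
  refine ⟨z, (hz (⟨y₀, hy₀⟩, ⟨1, Set.mem_Ioi.2 one_pos⟩)).1, fun y hy => ?_⟩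
  refine le_of_forall_pos_le_add fun ε hε => ?_
  rw [zero_add]
  exact (hz (⟨y, hy⟩, ⟨ε, hε⟩)).2

/-- For every `x ∈ H`, the resolvent set
`J_f x = {z ∈ K : f z y + ⟪z - x, y - z⟫ ≥ 0 for all y ∈ K}` is nonempty;
that is, the domain of the resolvent `J_f` is all of `H`. -/
theorem resolvent_domain_eq_univ
    {H : Type*} [NormedAddCommGroup H] [InnerProductSpace ℝ H] [CompleteSpace H]
    (K : Set H) (hK_ne : K.Nonempty) (hK_closed : IsClosed K) (hK_convex : Convex ℝ K)
    (f : H → H → ℝ)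
    (h1 : ∀ x ∈ K, f x x = 0)
    (h2 : ∀ x ∈ K, ∀ y ∈ K, f x y + f y x ≤ 0)
    (h3lsc : ∀ x ∈ K, LowerSemicontinuousOn (f x) K)
    (h3conv : ∀ x ∈ K, ConvexOn ℝ K (f x))
    (h4 : ∀ y ∈ K, ∀ x ∈ K, ∀ w ∈ K,
      Filter.limsup (fun t : ℝ => f ((1 - t) • x + t • w) y) (nhdsWithin 0 (Set.Ioi 0))
        ≤ f x y)
    (x : H) :
    ∃ z ∈ K, ∀ y ∈ K, 0 ≤ f z y + ⟪z - x, y - z⟫ := by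
  obtain ⟨z, hz, hminty⟩ :=
    exists_forall_add_inner_nonpos hK_ne hK_closed hK_convex h1 h2 h3lsc h3conv x
  refine ⟨z, hz, fun y hy => ?_⟩
  let p : ℝ → H := fun t => (1 - t) • z + t • y
  have hpK {t : ℝ} (ht0 : 0 < t) (ht1 : t < 1) : p t ∈ K :=
    hK_convex hz hy (by linarith) ht0.le (by ring)
  have hIoo : ∀ᶠ t : ℝ in nhdsWithin 0 (Set.Ioi 0), t ∈ Set.Ioo (0 : ℝ) 1 :=
    Ioo_mem_nhdsGT one_pos
  let c : ℝ → ℝ := fun t => -((1 - t) * ⟪z - x, y - z⟫)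
  have hlower {t : ℝ} (ht0 : 0 < t) (ht1 : t < 1) : c t ≤ f (p t) y := by
    have hm := hminty (p t) (hpK ht0 ht1)
    have hc := (h3conv _ (hpK ht0 ht1)).2 hz hy (by linarith : 0 ≤ 1 - t) ht0.le (by ring)
    have hd : f (p t) ((1 - t) • z + t • y) = 0 := h1 _ (hpK ht0 ht1)
    rw [hd, smul_eq_mul, smul_eq_mul] at hc
    have hsub : z - p t = (-t) • (y - z) := by
      simp only [p]
      module
    rw [hsub, real_inner_smul_right] at hm
    have : t * c t ≤ t * f (p t) y := by
      simp only [c]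
      nlinarith
    exact le_of_mul_le_mul_left this ht0
  have hp : Filter.Tendsto p (nhdsWithin 0 (Set.Ioi 0)) (nhdsWithin z K) := by
    refine tendsto_nhdsWithin_iff.2 ⟨?_, hIoo.mono fun t ht => hpK ht.1 ht.2⟩
    have : Continuous p := by fun_prop
    simpa [p] using (this.tendsto 0).mono_left nhdsWithin_le_nhds
  have hupper : Filter.IsBoundedUnder (· ≤ ·) (nhdsWithin 0 (Set.Ioi 0))
      fun t : ℝ => f (p t) y := by
    refine ⟨-(f y z - 1), Filter.eventually_map.2 ?_⟩
    filter_upwards [hIoo, hp.eventually (h3lsc y hy z hz (f y z - 1) (sub_one_lt _))] with t ht hlt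
    have := h2 _ (hpK ht.1 ht.2) y hy
    linarith
  have hc : Filter.Tendsto c (nhdsWithin 0 (Set.Ioi 0)) (nhds (-⟪z - x, y - z⟫)) := by
    have : Continuous c := by fun_prop
    simpa [c] using (this.tendsto 0).mono_left nhdsWithin_le_nhds
  refine le_of_forall_pos_le_add fun ε hε => ?_
  have hev : ∀ᶠ t : ℝ in nhdsWithin 0 (Set.Ioi 0), -⟪z - x, y - z⟫ - ε ≤ f (p t) y := by
    filter_upwards [hIoo, hc.eventually (lt_mem_nhds (sub_lt_self _ hε))] with t ht hlt
    exact hlt.le.trans (hlower ht.1 ht.2)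
  have hlim := (Filter.le_limsup_of_frequently_le hev.frequently hupper).trans (h4 y hy z hz y hy)
  linarith
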